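/- Let 𝕜 be ℝ or ℂ. Then the sequence n ↦ g[CP_n(𝕜)] is non-decreasing: g[CP_n(𝕜)] ≤ g[CP_{n+1}(𝕜)] for every n ≥ 1. -/

import Mathlib

open scoped BigOperators

/-- `geIter A k` is the Gaussian elimination iterate `A^{(k+1)}` (0-indexed, `geIter A 0 = A`).
Entries with row or column index `< k` are left unchanged; they are irrelevant. -/
noncomputable def geIter {𝕜 : Type*} [Field 𝕜] {n : ℕ} (A : Matrix (Fin n) (Fin n) 𝕜) :
    ℕ → Matrix (Fin n) (Fin n) 𝕜
  | 0 => A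
  | k + 1 => fun i j =>
    if h : k < n ∧ k + 1 ≤ i.1 ∧ k + 1 ≤ j.1 then
      geIter A k i j -
        geIter A k i ⟨k, h.1⟩ * geIter A k ⟨k, h.1⟩ j / geIter A k ⟨k, h.1⟩ ⟨k, h.1⟩
    else geIter A k i j

/-- The norm of the pivot `a^{(k+1)}_{k,k}` (0-indexed). -/
noncomputable def pivotNorm {𝕜 : Type*} [RCLike 𝕜] {n : ℕ}
    (A : Matrix (Fin n) (Fin n) 𝕜) (k : ℕ) : ℝ :=
  if h : k < n then ‖geIter A k ⟨k, h⟩ ⟨k, h⟩‖ else 0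

/-- The growth factor `g(A)`. -/
noncomputable def growth {𝕜 : Type*} [RCLike 𝕜] {n : ℕ} (A : Matrix (Fin n) (Fin n) 𝕜) : ℝ :=
  (⨆ k : Fin n, ⨆ i : Fin n, ⨆ j : Fin n,
      if k.1 ≤ i.1 ∧ k.1 ≤ j.1 then ‖geIter A k.1 i j‖ else 0) /
    ⨆ i : Fin n, ⨆ j : Fin n, ‖A i j‖

/-- `A` is completely pivoted: `A ∈ CP_n(𝕜)`. -/
def IsCP {𝕜 : Type*} [RCLike 𝕜] {n : ℕ} (A : Matrix (Fin n) (Fin n) 𝕜) : Prop :=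
  A.det ≠ 0 ∧ (∀ k : ℕ, k + 1 < n → pivotNorm A k ≠ 0) ∧
    ∀ (k : ℕ) (i j : Fin n), k ≤ i.1 → k ≤ j.1 → ‖geIter A k i j‖ ≤ pivotNorm A k

/-- `g[CP_n(𝕜)]`. -/
noncomputable def gCP (𝕜 : Type*) [RCLike 𝕜] (n : ℕ) : ℝ :=
  sSup (growth '' {A : Matrix (Fin n) (Fin n) 𝕜 | IsCP A})

theorem geIter_succ_apply {𝕜 : Type*} [Field 𝕜] {n : ℕ} (A : Matrix (Fin n) (Fin n) 𝕜)
    (k : ℕ) (i j : Fin n) : geIter A (k + 1) i j =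
    if h : k < n ∧ k + 1 ≤ i.1 ∧ k + 1 ≤ j.1 then
      geIter A k i j -
        geIter A k i ⟨k, h.1⟩ * geIter A k ⟨k, h.1⟩ j / geIter A k ⟨k, h.1⟩ ⟨k, h.1⟩
    else geIter A k i j := rfl

/-- The matrix `[M] ⊕ A`. -/
def bordered {𝕜 : Type*} [Field 𝕜] {n : ℕ} (M : 𝕜) (A : Matrix (Fin n) (Fin n) 𝕜) :
    Matrix (Fin (n + 1)) (Fin (n + 1)) 𝕜 :=
  fun i j => Fin.cases (Fin.cases M (fun _ => 0) j)
    (fun i' => Fin.cases 0 (fun j' => A i' j') j) i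

theorem bordered_det {𝕜 : Type*} [Field 𝕜] {n : ℕ} (M : 𝕜) (A : Matrix (Fin n) (Fin n) 𝕜) :
    (bordered M A).det = M * A.det := by
  rw [Matrix.det_succ_row_zero, Fin.sum_univ_succ]
  have : (bordered M A).submatrix Fin.succ Fin.succ = A := by
    ext i j; simp [bordered]
  simp [this]
  simp [bordered]

theorem geIter_bordered {𝕜 : Type*} [Field 𝕜] {n : ℕ} (M : 𝕜) (A : Matrix (Fin n) (Fin n) 𝕜)
    (k : ℕ) : ∀ i j : Fin n, geIter (bordered M A) (k + 1) i.succ j.succ = geIter A k i j := by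
  induction k with
  | zero => intro i j; simp [geIter, bordered]
  | succ k ih =>
    intro i j
    rw [geIter_succ_apply (bordered M A), geIter_succ_apply A]
    by_cases h : k < n ∧ k + 1 ≤ i.1 ∧ k + 1 ≤ j.1
    · have h' : k + 1 < n + 1 ∧ k + 1 + 1 ≤ i.succ.1 ∧ k + 1 + 1 ≤ j.succ.1 := by
        simp only [Fin.val_succ]; omega
      rw [dif_pos h, dif_pos h']
      have e : (⟨k + 1, h'.1⟩ : Fin (n + 1)) = Fin.succ ⟨k, h.1⟩ := rfl
      rw [e, ih, ih, ih, ih]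
    · have h' : ¬ (k + 1 < n + 1 ∧ k + 1 + 1 ≤ i.succ.1 ∧ k + 1 + 1 ≤ j.succ.1) := by
        simp only [Fin.val_succ]; omega
      rw [dif_neg h, dif_neg h', ih]

theorem pivotNorm_bordered {𝕜 : Type*} [RCLike 𝕜] {n : ℕ} (M : 𝕜)
    (A : Matrix (Fin n) (Fin n) 𝕜) (k : ℕ) :
    pivotNorm (bordered M A) (k + 1) = pivotNorm A k := by
  unfold pivotNorm
  by_cases h : k < n
  · rw [dif_pos h, dif_pos (by omega : k + 1 < n + 1), ← geIter_bordered M A]; rfl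
  · rw [dif_neg h, dif_neg (by omega)]

theorem pivotNorm_nonneg {𝕜 : Type*} [RCLike 𝕜] {n : ℕ}
    (A : Matrix (Fin n) (Fin n) 𝕜) (k : ℕ) : 0 ≤ pivotNorm A k := by
  unfold pivotNorm; split_ifs <;> positivity

theorem le_iSup_fin {n : ℕ} (f : Fin n → ℝ) (i : Fin n) : f i ≤ ⨆ i, f i :=
  le_ciSup (Set.finite_range f).bddAbove i

theorem growth_den {𝕜 : Type*} [RCLike 𝕜] {n : ℕ} (hn : 1 ≤ n)
    {A : Matrix (Fin n) (Fin n) 𝕜} (hA : IsCP A) :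
    (⨆ i : Fin n, ⨆ j : Fin n, ‖A i j‖) = pivotNorm A 0 := by
  apply le_antisymm
  · exact Real.iSup_le (fun i => Real.iSup_le (fun j => hA.2.2 0 i j (by omega) (by omega))
      (pivotNorm_nonneg A 0)) (pivotNorm_nonneg A 0)
  · unfold pivotNorm
    rw [dif_pos (by omega : 0 < n)]
    exact (le_iSup_fin (fun j => ‖A ⟨0, hn⟩ j‖) ⟨0, hn⟩).trans
      (le_iSup_fin (fun i => ⨆ j, ‖A i j‖) ⟨0, hn⟩)

theorem pivotNorm_zero_pos {𝕜 : Type*} [RCLike 𝕜] {n : ℕ} (hn : 1 ≤ n)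
    {A : Matrix (Fin n) (Fin n) 𝕜} (hA : IsCP A) : 0 < pivotNorm A 0 := by
  refine lt_of_le_of_ne (pivotNorm_nonneg A 0) fun h => hA.1 ?_
  have hA0 : A = 0 := by
    ext i j
    have := hA.2.2 0 i j (by omega) (by omega)
    rw [← h] at this
    exact norm_le_zero_iff.1 this
  have hne : Nonempty (Fin n) := ⟨⟨0, hn⟩⟩
  rw [hA0, Matrix.det_zero]

theorem pivotNorm_succ_le {𝕜 : Type*} [RCLike 𝕜] {n : ℕ}
    {A : Matrix (Fin n) (Fin n) 𝕜} (hA : IsCP A) (k : ℕ) :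
    pivotNorm A (k + 1) ≤ 2 * pivotNorm A k := by
  by_cases h : k + 1 < n
  · have hk : k < n := by omega
    have h1 := hA.2.2 k ⟨k + 1, h⟩ ⟨k + 1, h⟩ (by simp) (by simp)
    have h2 := hA.2.2 k ⟨k + 1, h⟩ ⟨k, hk⟩ (by simp) (by simp)
    have h3 := hA.2.2 k ⟨k, hk⟩ ⟨k + 1, h⟩ (by simp) (by simp)
    have h0 : 0 < pivotNorm A k :=
      lt_of_le_of_ne (pivotNorm_nonneg A k) (Ne.symm (hA.2.1 k h))
    have hp : pivotNorm A k = ‖geIter A k ⟨k, hk⟩ ⟨k, hk⟩‖ := by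
      unfold pivotNorm; rw [dif_pos hk]
    conv_lhs => unfold pivotNorm
    rw [dif_pos h, geIter_succ_apply, dif_pos ⟨hk, le_refl (k + 1), le_refl (k + 1)⟩]
    refine (norm_sub_le _ _).trans ?_
    rw [norm_div, norm_mul, ← hp]
    have : ‖geIter A k ⟨k + 1, h⟩ ⟨k, hk⟩‖ * ‖geIter A k ⟨k, hk⟩ ⟨k + 1, h⟩‖ / pivotNorm A k
        ≤ pivotNorm A k := by
      rw [div_le_iff₀ h0]
      exact mul_le_mul h2 h3 (norm_nonneg _) h0.le
    linarith
  · have := pivotNorm_nonneg A k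
    conv_lhs => unfold pivotNorm
    rw [dif_neg h]; linarith

theorem pivotNorm_le {𝕜 : Type*} [RCLike 𝕜] {n : ℕ}
    {A : Matrix (Fin n) (Fin n) 𝕜} (hA : IsCP A) (k : ℕ) :
    pivotNorm A k ≤ 2 ^ k * pivotNorm A 0 := by
  induction k with
  | zero => simp
  | succ k ih =>
    have := pivotNorm_succ_le hA k
    rw [pow_succ]; linarith

theorem growth_le {𝕜 : Type*} [RCLike 𝕜] {n : ℕ} (hn : 1 ≤ n)
    {A : Matrix (Fin n) (Fin n) 𝕜} (hA : IsCP A) : growth A ≤ 2 ^ n := by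
  unfold growth
  have h0 := pivotNorm_zero_pos hn hA
  rw [growth_den hn hA, div_le_iff₀ h0]
  have hz : 0 ≤ 2 ^ n * pivotNorm A 0 := by positivity
  refine Real.iSup_le (fun k => Real.iSup_le (fun i => Real.iSup_le (fun j => ?_) hz) hz) hz
  split_ifs with h
  · refine (hA.2.2 k i j h.1 h.2).trans ((pivotNorm_le hA k).trans ?_)
    gcongr
    · norm_num
    · exact k.2.le
  · exact hz

theorem bordered_isCP {𝕜 : Type*} [RCLike 𝕜] {n : ℕ} (hn : 1 ≤ n)
    {A : Matrix (Fin n) (Fin n) 𝕜} (hA : IsCP A) :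
    pivotNorm (bordered (pivotNorm A 0 : 𝕜) A) 0 = pivotNorm A 0 ∧
    IsCP (bordered (pivotNorm A 0 : 𝕜) A) := by
  have h0 := pivotNorm_zero_pos hn hA
  have hp : pivotNorm (bordered (pivotNorm A 0 : 𝕜) A) 0 = pivotNorm A 0 := by
    conv_lhs => unfold pivotNorm
    rw [dif_pos (by omega : 0 < n + 1)]
    change ‖((pivotNorm A 0 : ℝ) : 𝕜)‖ = _
    rw [RCLike.norm_ofReal, abs_of_pos h0]
  refine ⟨hp, ?_, ?_, ?_⟩
  · rw [bordered_det]
    exact mul_ne_zero (by exact_mod_cast h0.ne') hA.1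
  · intro k hk
    cases k with
    | zero => rw [hp]; exact h0.ne'
    | succ k => rw [pivotNorm_bordered]; exact hA.2.1 k (by omega)
  · intro k i j hi hj
    cases k with
    | zero =>
      rw [hp]
      change ‖bordered (pivotNorm A 0 : 𝕜) A i j‖ ≤ _
      refine Fin.cases ?_ (fun i => ?_) i <;> refine Fin.cases ?_ (fun j => ?_) j
      · change ‖((pivotNorm A 0 : ℝ) : 𝕜)‖ ≤ _
        rw [RCLike.norm_ofReal, abs_of_pos h0]
      · simpa [bordered] using h0.le
      · simpa [bordered] using h0.le
      · exact hA.2.2 0 i j (by omega) (by omega)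
    | succ k =>
      rw [pivotNorm_bordered]
      obtain ⟨i, rfl⟩ := Fin.exists_succ_eq.2 (show i ≠ 0 by rintro rfl; simp at hi)
      obtain ⟨j, rfl⟩ := Fin.exists_succ_eq.2 (show j ≠ 0 by rintro rfl; simp at hj)
      rw [geIter_bordered]
      simp only [Fin.val_succ] at hi hj
      exact hA.2.2 k i j (by omega) (by omega)

theorem growth_le_bordered {𝕜 : Type*} [RCLike 𝕜] {n : ℕ} (hn : 1 ≤ n)
    {A : Matrix (Fin n) (Fin n) 𝕜} (hA : IsCP A) :
    growth A ≤ growth (bordered (pivotNorm A 0 : 𝕜) A) := by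
  obtain ⟨hp, hB⟩ := bordered_isCP hn hA
  have h0 := pivotNorm_zero_pos hn hA
  unfold growth
  rw [growth_den hn hA, growth_den (by omega) hB, hp]
  set B := bordered (pivotNorm A 0 : 𝕜) A with hBdef
  apply div_le_div_of_nonneg_right _ h0.le
  have hz : 0 ≤ ⨆ k : Fin (n + 1), ⨆ i : Fin (n + 1), ⨆ j : Fin (n + 1),
      if k.1 ≤ i.1 ∧ k.1 ≤ j.1 then ‖geIter B k.1 i j‖ else 0 := by
    refine Real.iSup_nonneg fun k => Real.iSup_nonneg fun i => Real.iSup_nonneg fun j => ?_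
    split_ifs <;> positivity
  refine Real.iSup_le (fun k => Real.iSup_le (fun i => Real.iSup_le (fun j => ?_) hz) hz) hz
  have e : (if k.1 ≤ i.1 ∧ k.1 ≤ j.1 then ‖geIter A k.1 i j‖ else 0)
      = if k.succ.1 ≤ i.succ.1 ∧ k.succ.1 ≤ j.succ.1 then ‖geIter B k.succ.1 i.succ j.succ‖
        else 0 := by
    simp only [Fin.val_succ, hBdef, geIter_bordered, add_le_add_iff_right]
  rw [e]
  refine (le_iSup_fin (fun j' : Fin (n + 1) => if k.succ.1 ≤ i.succ.1 ∧ k.succ.1 ≤ j'.1 then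
    ‖geIter B k.succ.1 i.succ j'‖ else 0) j.succ).trans ?_
  refine (le_iSup_fin (fun i' : Fin (n + 1) => ⨆ j' : Fin (n + 1),
    if k.succ.1 ≤ i'.1 ∧ k.succ.1 ≤ j'.1 then ‖geIter B k.succ.1 i' j'‖ else 0) i.succ).trans ?_
  exact le_iSup_fin (fun k' : Fin (n + 1) => ⨆ i' : Fin (n + 1), ⨆ j' : Fin (n + 1),
    if k'.1 ≤ i'.1 ∧ k'.1 ≤ j'.1 then ‖geIter B k'.1 i' j'‖ else 0) k.succ

theorem growth_nonneg {𝕜 : Type*} [RCLike 𝕜] {n : ℕ} (A : Matrix (Fin n) (Fin n) 𝕜) :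
    0 ≤ growth A := by
  unfold growth
  refine div_nonneg ?_ ?_
  · refine Real.iSup_nonneg fun k => Real.iSup_nonneg fun i => Real.iSup_nonneg fun j => ?_
    split_ifs <;> positivity
  · exact Real.iSup_nonneg fun i => Real.iSup_nonneg fun j => norm_nonneg _

/-- `n ↦ g[CP_n(𝕜)]` is non-decreasing. -/
theorem gCP_monotone {𝕜 : Type*} [RCLike 𝕜] (n : ℕ) (hn : 1 ≤ n) :
    gCP 𝕜 n ≤ gCP 𝕜 (n + 1) := by
  unfold gCP
  refine Real.sSup_le ?_ (Real.sSup_nonneg ?_)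
  · rintro _ ⟨A, hA, rfl⟩
    refine (growth_le_bordered hn hA).trans (le_csSup ⟨2 ^ (n + 1), ?_⟩
      ⟨_, (bordered_isCP hn hA).2, rfl⟩)
    rintro _ ⟨C, hC, rfl⟩
    exact growth_le (by omega) hC
  · rintro _ ⟨A, _, rfl⟩
    exact growth_nonneg A
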